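/- Let V be a real inner product space, let c > 0 and b > 0, and let λ_τ, u̇_τ ∈ V. Then λ_τ is a fixed point of the tangential Uzawa/return-map update, i.e. λ_τ = (b / max(b, ‖λ_τ + c·u̇_τ‖))·(λ_τ + c·u̇_τ), if and only if the Coulomb friction conditions with friction bound b hold: ‖λ_τ‖ ≤ b; ‖λ_τ‖ < b implies u̇_τ = 0; and ‖λ_τ‖ = b implies there exists ζ ≥ 0 with u̇_τ = ζ·λ_τ. -/

import Mathlib

/-- `λ_τ` is a fixed point of the tangential Uzawa/return-map update iff the
Coulomb friction conditions with friction bound `b` hold. -/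
theorem tangential_uzawa_fixed_point_iff_coulomb
    {V : Type*} [NormedAddCommGroup V] [InnerProductSpace ℝ V]
    (c b : ℝ) (hc : 0 < c) (hb : 0 < b) (lamT udotT : V) :
    lamT = (b / max b ‖lamT + c • udotT‖) • (lamT + c • udotT) ↔
      (‖lamT‖ ≤ b ∧ (‖lamT‖ < b → udotT = 0) ∧
        (‖lamT‖ = b → ∃ ζ : ℝ, 0 ≤ ζ ∧ udotT = ζ • lamT)) := by
  constructor
  · intro h
    rcases le_or_gt ‖lamT + c • udotT‖ b with hN | hN
    · rw [max_eq_left hN, div_self hb.ne', one_smul, left_eq_add, smul_eq_zero] at h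
      have hu : udotT = 0 := h.resolve_left hc.ne'
      subst hu
      exact ⟨by simpa using hN, fun _ => rfl, fun _ => ⟨0, le_rfl, by simp⟩⟩
    · rw [max_eq_right hN.le] at h
      set N := ‖lamT + c • udotT‖ with hN_def
      have hN0 : 0 < N := hb.trans hN
      have hnorm : ‖lamT‖ = b := by
        rw [h, norm_smul, ← hN_def, Real.norm_of_nonneg (by positivity)]
        field_simp
      refine ⟨hnorm.le, fun hlt => absurd hnorm hlt.ne, fun _ => ⟨(N / b - 1) / c, ?_, ?_⟩⟩
      · have : 1 ≤ N / b := (one_le_div hb).2 hN.le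
        exact div_nonneg (by linarith) hc.le
      · have hw : (N / b) • lamT = lamT + c • udotT := by
          conv_lhs => rw [h]
          rw [smul_smul, div_mul_div_cancel₀ hb.ne', div_self hN0.ne', one_smul]
        rw [div_eq_inv_mul, mul_smul, sub_smul, hw, one_smul, add_sub_cancel_left,
          inv_smul_smul₀ hc.ne']
  · rintro ⟨hle, hstick, hslip⟩
    rcases hle.lt_or_eq with hlt | heq
    · simp [hstick hlt, max_eq_left hle, hb.ne']
    · obtain ⟨ζ, hζ, rfl⟩ := hslip heq
      have hw : lamT + c • ζ • lamT = (1 + c * ζ) • lamT := by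
        rw [add_smul, one_smul, mul_smul]
      have hk : 0 ≤ c * ζ := mul_nonneg hc.le hζ
      have hk1 : 0 < 1 + c * ζ := by linarith
      have hmax : b ≤ (1 + c * ζ) * b := le_mul_of_one_le_left hb.le (by linarith)
      rw [hw, norm_smul, heq, Real.norm_of_nonneg hk1.le, max_eq_right hmax, smul_smul,
        div_mul_cancel_right₀ hb.ne', inv_mul_cancel₀ hk1.ne', one_smul]
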